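/- The equation ±(1/2^n) ∏_{i=1}^P p_i^{n_i − k_i^1 − k_i^2} = −(1/2^n) ∏_{i=1}^P p_i^{n_i − 2k_i^1} (with either choice of sign on the left, and all exponents integers, p_i distinct odd primes) forces k_i^1 = k_i^2 for all i. Hence Verma modules with Δ = c/24 (i.e. t = −s/r) never have two-dimensional singular spaces. -/

import Mathlib

/-- The equation `±(1/2^n)∏ pᵢ^{nᵢ-kᵢ¹-kᵢ²} = -(1/2^n)∏ pᵢ^{nᵢ-2kᵢ¹}` forces
`π¹ = π²`: Verma modules with `Δ = c/24` never have two-dimensional singular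
spaces. -/
theorem stmt_8 (n P : ℕ) (p e : Fin P → ℕ)
    (hn : 1 ≤ n)
    (hp : ∀ i, (p i).Prime) (hodd : ∀ i, Odd (p i))
    (hinj : Function.Injective p)
    (k1 k2 : Fin P → ℕ) (hk1 : ∀ i, k1 i ≤ e i) (hk2 : ∀ i, k2 i ≤ e i)
    (ε : ℝ) (hε : ε = 1 ∨ ε = -1)
    (h : ε * (((2 : ℝ) ^ n)⁻¹ * ∏ i, (p i : ℝ) ^ ((e i : ℤ) - k1 i - k2 i))
      = -(((2 : ℝ) ^ n)⁻¹ * ∏ i, (p i : ℝ) ^ ((e i : ℤ) - 2 * k1 i))) :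
    k1 = k2 := by
  have h2 : (0 : ℝ) < ((2 : ℝ) ^ n)⁻¹ := by positivity
  have hp0 : ∀ i, (0 : ℝ) < (p i : ℝ) := fun i => by exact_mod_cast (hp i).pos
  have hA : 0 < ∏ i, (p i : ℝ) ^ ((e i : ℤ) - k1 i - k2 i) :=
    Finset.prod_pos fun i _ => zpow_pos (hp0 i) _
  have hB : 0 < ∏ i, (p i : ℝ) ^ ((e i : ℤ) - 2 * k1 i) :=
    Finset.prod_pos fun i _ => zpow_pos (hp0 i) _
  have hAB : ∏ i, (p i : ℝ) ^ ((e i : ℤ) - k1 i - k2 i)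
      = ∏ i, (p i : ℝ) ^ ((e i : ℤ) - 2 * k1 i) := by
    rcases hε with rfl | rfl
    · have h3 := mul_pos h2 hA
      have h4 := mul_pos h2 hB
      linarith
    · apply mul_left_cancel₀ h2.ne'
      linarith
  have hR : ∏ i, (p i : ℝ) ^ (e i + k1 i) = ∏ i, (p i : ℝ) ^ (e i + k2 i) := by
    have h5 := congrArg (fun x => x * ∏ i, (p i : ℝ) ^ ((2 * k1 i + k2 i : ℕ) : ℤ)) hAB
    simp only [← Finset.prod_mul_distrib] at h5
    have e1 : ∀ i, (p i : ℝ) ^ ((e i : ℤ) - k1 i - k2 i) * (p i : ℝ) ^ ((2 * k1 i + k2 i : ℕ) : ℤ)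
        = (p i : ℝ) ^ (e i + k1 i) := fun i => by
      rw [← zpow_add₀ (hp0 i).ne', ← zpow_natCast]
      congr 1
      push_cast
      ring
    have e2 : ∀ i, (p i : ℝ) ^ ((e i : ℤ) - 2 * k1 i) * (p i : ℝ) ^ ((2 * k1 i + k2 i : ℕ) : ℤ)
        = (p i : ℝ) ^ (e i + k2 i) := fun i => by
      rw [← zpow_add₀ (hp0 i).ne', ← zpow_natCast]
      congr 1
      push_cast
      ring
    simpa only [e1, e2] using h5
  have hN : ∏ i, (p i) ^ (e i + k1 i) = ∏ i, (p i) ^ (e i + k2 i) := by exact_mod_cast hR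
  have key : ∀ (f : Fin P → ℕ) (j : Fin P), (∏ i, (p i) ^ (f i)).factorization (p j) = f j := by
    intro f j
    rw [Nat.factorization_prod fun i _ => pow_ne_zero _ (hp i).ne_zero]
    rw [Finsupp.finsetSum_apply, Finset.sum_eq_single j]
    · simp [(hp j).factorization]
    · intro i _ hij
      have : p i ≠ p j := fun hh => hij (hinj hh)
      simp [(hp i).factorization, this]
    · simp
  funext j
  have h6 := key (fun i => e i + k1 i) j
  have h7 := key (fun i => e i + k2 i) j
  simp only [hN] at h6
  omega
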